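/- arXiv:1403.0534 — 8 statements merged into one kernel-verified Lean document; each statement's English description precedes it below -/
import Mathlib

section
/- Let A be a commutative Noetherian ring, I ⊆ A an ideal, M a finitely generated A-module, and m ≥ 1 an integer. Then the canonical levelwise maps of pro A-modules {M[m] ⊗_A A/I^s}_s → {(M/I^sM)[m]}_s and {(M/mM) ⊗_A A/I^s}_s → {M/(mM + I^sM)}_s are isomorphisms of pro A-modules, where N[m] denotes the m-torsion submodule {x ∈ N : mx = 0}. -/
open TensorProduct

/-- Given an `A`-linear map `f : N → T` where `T` is killed by the ideal `J`, the canonical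
induced `A`-linear map `N ⊗_A A/J → T`, sending `x ⊗ (a mod J)` to `a • f x`. -/
noncomputable def canonMap {A : Type*} [CommRing A] (J : Ideal A)
    {N T : Type*} [AddCommGroup N] [Module A N] [AddCommGroup T] [Module A T]
    (f : N →ₗ[A] T) (h : ∀ a ∈ J, ∀ t : T, a • t = 0) :
    (N ⊗[A] (A ⧸ J)) →ₗ[A] T :=
  (Submodule.liftQ (J • (⊤ : Submodule A N)) f
      (by
        rw [Submodule.smul_le]
        intro a ha x _
        rw [LinearMap.mem_ker, LinearMap.map_smul]
        exact h a ha (f x))).comp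
    (TensorProduct.tensorQuotEquivQuotSMul N J).toLinearMap

section
variable {A : Type*} [CommRing A] (I : Ideal A) (m : ℕ)
  (M : Type*) [AddCommGroup M] [Module A M]

/-- The canonical map `M[m] ⊗_A A/I^s → (M/I^sM)[m]` on `m`-torsion submodules. -/
noncomputable def torsionCanonMap (s : ℕ) :
    ((Submodule.torsionBy A M (m : A)) ⊗[A] (A ⧸ (I ^ s : Ideal A))) →ₗ[A]
      (Submodule.torsionBy A (M ⧸ (I ^ s • ⊤ : Submodule A M)) (m : A)) :=
  canonMap (I ^ s)
    ((Submodule.mkQ (I ^ s • ⊤ : Submodule A M)).restrict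
      (fun x hx => by
        rw [Submodule.mem_torsionBy_iff] at hx ⊢
        rw [Submodule.mkQ_apply, ← Submodule.Quotient.mk_smul, hx,
          Submodule.Quotient.mk_zero]))
    (fun a ha t => by
      ext
      obtain ⟨y, hy⟩ := Submodule.Quotient.mk_surjective _ (t : M ⧸ (I ^ s • ⊤ : Submodule A M))
      rw [Submodule.coe_smul, ← hy, ← Submodule.Quotient.mk_smul, ZeroMemClass.coe_zero,
        Submodule.Quotient.mk_eq_zero]
      exact Submodule.smul_mem_smul ha Submodule.mem_top)
end

section
variable {A : Type*} [CommRing A] (I : Ideal A) (m : ℕ)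
  (M : Type*) [AddCommGroup M] [Module A M]

/-- The canonical map `(M/mM) ⊗_A A/I^s → M/(mM + I^sM)`. -/
noncomputable def cotorCanonMap (s : ℕ) :
    ((M ⧸ (Ideal.span {(m : A)} • ⊤ : Submodule A M)) ⊗[A] (A ⧸ (I ^ s : Ideal A))) →ₗ[A]
      (M ⧸ (Ideal.span {(m : A)} • ⊤ ⊔ I ^ s • ⊤ : Submodule A M)) :=
  canonMap (I ^ s)
    (Submodule.mapQ _ _ LinearMap.id (fun x hx => Submodule.mem_sup_left hx))
    (fun a ha t => by
      obtain ⟨y, hy⟩ := Submodule.Quotient.mk_surjective _ t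
      rw [← hy, ← Submodule.Quotient.mk_smul, Submodule.Quotient.mk_eq_zero]
      exact Submodule.mem_sup_right (Submodule.smul_mem_smul ha Submodule.mem_top))

/-- The transition map `(M/I^sM)[m] → (M/I^rM)[m]` for `r ≤ s`. -/
noncomputable def torsionTrans {r s : ℕ} (h : r ≤ s) :
    (Submodule.torsionBy A (M ⧸ (I ^ s • ⊤ : Submodule A M)) (m : A)) →ₗ[A]
      (Submodule.torsionBy A (M ⧸ (I ^ r • ⊤ : Submodule A M)) (m : A)) :=
  (Submodule.mapQ (I ^ s • ⊤ : Submodule A M) (I ^ r • ⊤ : Submodule A M) LinearMap.id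
      (fun x hx => Submodule.smul_mono (Ideal.pow_le_pow_right h) le_rfl hx)).restrict
    (fun x hx => by
      rw [Submodule.mem_torsionBy_iff] at hx ⊢
      rw [← map_smul, hx, map_zero])

/-- The transition map `M/(mM + I^sM) → M/(mM + I^rM)` for `r ≤ s`. -/
noncomputable def cotorTrans {r s : ℕ} (h : r ≤ s) :
    (M ⧸ (Ideal.span {(m : A)} • ⊤ ⊔ I ^ s • ⊤ : Submodule A M)) →ₗ[A]
      (M ⧸ (Ideal.span {(m : A)} • ⊤ ⊔ I ^ r • ⊤ : Submodule A M)) :=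
  Submodule.mapQ _ _ LinearMap.id
    (sup_le_sup le_rfl (Submodule.smul_mono (Ideal.pow_le_pow_right h) le_rfl))

/-- The transition map `N ⊗_A A/I^s → N ⊗_A A/I^r` for `r ≤ s`. -/
noncomputable def tensorTrans (N : Type*) [AddCommGroup N] [Module A N] {r s : ℕ} (h : r ≤ s) :
    (N ⊗[A] (A ⧸ (I ^ s : Ideal A))) →ₗ[A] (N ⊗[A] (A ⧸ (I ^ r : Ideal A))) :=
  LinearMap.lTensor N
    (Submodule.mapQ (I ^ s : Ideal A) (I ^ r : Ideal A) LinearMap.id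
      (fun x hx => Ideal.pow_le_pow_right h hx))

end

section
variable {A : Type*} [CommRing A]

theorem canonMap_tmul_one (J : Ideal A) {N T : Type*} [AddCommGroup N] [Module A N]
    [AddCommGroup T] [Module A T] (f : N →ₗ[A] T) (h : ∀ a ∈ J, ∀ t : T, a • t = 0) (n : N) :
    canonMap J f h (n ⊗ₜ[A] 1) = f n := by
  have key : tensorQuotEquivQuotSMul N J (n ⊗ₜ[A] 1) = Submodule.Quotient.mk n := by
    simpa using tensorQuotEquivQuotSMul_tmul_mk J n 1
  simp [canonMap, key]

theorem exists_eq_tmul_one (J : Ideal A) {N : Type*} [AddCommGroup N] [Module A N]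
    (x : N ⊗[A] (A ⧸ J)) : ∃ n : N, x = n ⊗ₜ[A] 1 := by
  obtain ⟨n, hn⟩ := Submodule.Quotient.mk_surjective _ (tensorQuotEquivQuotSMul N J x)
  exact ⟨n, by rw [← tensorQuotEquivQuotSMul_symm_mk, hn, LinearEquiv.symm_apply_apply]⟩

theorem tmul_one_eq_zero (J : Ideal A) {N : Type*} [AddCommGroup N] [Module A N]
    {n : N} (hn : n ∈ J • (⊤ : Submodule A N)) : n ⊗ₜ[A] (1 : A ⧸ J) = 0 := by
  rw [← tensorQuotEquivQuotSMul_symm_mk, (Submodule.Quotient.mk_eq_zero _).mpr hn, map_zero]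

theorem tensorTrans_tmul_one (I : Ideal A) (N : Type*) [AddCommGroup N] [Module A N] {r s : ℕ}
    (h : r ≤ s) (n : N) : tensorTrans I N h (n ⊗ₜ[A] 1) = n ⊗ₜ[A] 1 :=
  rfl

/-- A weak form of the Artin-Rees lemma. -/
theorem exists_pow_smul_top_inf_le [IsNoetherianRing A] (I : Ideal A) {M : Type*}
    [AddCommGroup M] [Module A M] [Module.Finite A M] (N : Submodule A M) (r : ℕ) :
    ∃ s, r ≤ s ∧ (I ^ s • ⊤ : Submodule A M) ⊓ N ≤ I ^ r • N := by
  obtain ⟨k, hk⟩ := I.exists_pow_inf_eq_pow_smul N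
  refine ⟨r + k, Nat.le_add_right r k, ?_⟩
  rw [hk (r + k) (Nat.le_add_left k r), Nat.add_sub_cancel]
  exact Submodule.smul_mono le_rfl inf_le_right

theorem mem_smul_top_of_coe_mem {M : Type*} [AddCommGroup M] [Module A M] (J : Ideal A)
    {N : Submodule A M} {x : N} (hx : (x : M) ∈ J • N) : x ∈ J • (⊤ : Submodule A N) := by
  have h : J • N = (J • (⊤ : Submodule A N)).map N.subtype := by
    rw [Submodule.map_smul'', Submodule.map_top, N.range_subtype]
  rw [h] at hx
  obtain ⟨y, hy, hyx⟩ := hx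
  rwa [← Subtype.ext hyx]

end

/-- **Statement 3.** Let `A` be a commutative Noetherian ring, `I ⊆ A` an ideal, `M` a finitely
generated `A`-module, and `m ≥ 1` an integer.  Then the canonical levelwise maps of pro
`A`-modules `{M[m] ⊗_A A/I^s}_s → {(M/I^sM)[m]}_s` and
`{(M/mM) ⊗_A A/I^s}_s → {M/(mM + I^sM)}_s` are isomorphisms of pro `A`-modules, i.e. for each
of the two maps both the inverse system of kernels and the inverse system of cokernels vanish
(satisfy the trivial Mittag-Leffler condition). -/
theorem statement3 (A : Type*) [CommRing A] [IsNoetherianRing A] (I : Ideal A)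
    (M : Type*) [AddCommGroup M] [Module A M] [Module.Finite A M]
    (m : ℕ) (hm : 1 ≤ m) :
    -- the pro-kernels of the first map vanish
    ((∀ r : ℕ, ∃ s : ℕ, ∃ hs : r ≤ s,
      ∀ x : (Submodule.torsionBy A M (m : A)) ⊗[A] (A ⧸ (I ^ s : Ideal A)),
        torsionCanonMap I m M s x = 0 → tensorTrans I (Submodule.torsionBy A M (m : A)) hs x = 0) ∧
    -- the pro-cokernels of the first map vanish
    (∀ r : ℕ, ∃ s : ℕ, ∃ hs : r ≤ s,
      ∀ y : Submodule.torsionBy A (M ⧸ (I ^ s • ⊤ : Submodule A M)) (m : A),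
        torsionTrans I m M hs y ∈ LinearMap.range (torsionCanonMap I m M r))) ∧
    -- the pro-kernels of the second map vanish
    ((∀ r : ℕ, ∃ s : ℕ, ∃ hs : r ≤ s,
      ∀ x : (M ⧸ (Ideal.span {(m : A)} • ⊤ : Submodule A M)) ⊗[A] (A ⧸ (I ^ s : Ideal A)),
        cotorCanonMap I m M s x = 0 →
          tensorTrans I (M ⧸ (Ideal.span {(m : A)} • ⊤ : Submodule A M)) hs x = 0) ∧
    -- the pro-cokernels of the second map vanish
    (∀ r : ℕ, ∃ s : ℕ, ∃ hs : r ≤ s,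
      ∀ y : M ⧸ (Ideal.span {(m : A)} • ⊤ ⊔ I ^ s • ⊤ : Submodule A M),
        cotorTrans I m M hs y ∈ LinearMap.range (cotorCanonMap I m M r))) := by
  refine ⟨⟨fun r => ?_, fun r => ?_⟩, fun r => ?_, fun r => ?_⟩
  · obtain ⟨s, hs, hle⟩ := exists_pow_smul_top_inf_le I (Submodule.torsionBy A M (m : A)) r
    refine ⟨s, hs, fun x hx => ?_⟩
    obtain ⟨n, rfl⟩ := exists_eq_tmul_one _ x
    rw [torsionCanonMap, canonMap_tmul_one] at hx
    rw [tensorTrans_tmul_one]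
    refine tmul_one_eq_zero _ (mem_smul_top_of_coe_mem _ (hle ⟨?_, n.2⟩))
    exact (Submodule.Quotient.mk_eq_zero _).mp (congrArg Subtype.val hx)
  · obtain ⟨s, hs, hle⟩ :=
      exists_pow_smul_top_inf_le I (LinearMap.range (LinearMap.lsmul A M (m : A))) r
    refine ⟨s, hs, ?_⟩
    rintro ⟨y, hy⟩
    obtain ⟨y, rfl⟩ := Submodule.Quotient.mk_surjective _ y
    rw [Submodule.mem_torsionBy_iff, ← Submodule.Quotient.mk_smul,
      Submodule.Quotient.mk_eq_zero] at hy
    have h := hle ⟨hy, y, rfl⟩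
    rw [← Submodule.map_top, ← Submodule.map_smul''] at h
    obtain ⟨z, hz, hzy⟩ := h
    have hyz : y - z ∈ Submodule.torsionBy A M (m : A) := by
      rw [Submodule.mem_torsionBy_iff, smul_sub, sub_eq_zero]
      exact hzy.symm
    refine ⟨⟨y - z, hyz⟩ ⊗ₜ[A] 1, ?_⟩
    rw [torsionCanonMap, canonMap_tmul_one]
    refine Subtype.ext ((Submodule.Quotient.eq _).mpr ?_)
    simpa using hz
  · refine ⟨r, le_rfl, fun x hx => ?_⟩
    obtain ⟨n, rfl⟩ := exists_eq_tmul_one _ x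
    obtain ⟨n, rfl⟩ := Submodule.Quotient.mk_surjective _ n
    rw [cotorCanonMap, canonMap_tmul_one] at hx
    rw [tensorTrans_tmul_one]
    apply tmul_one_eq_zero
    obtain ⟨a, ha, b, hb, rfl⟩ := Submodule.mem_sup.mp ((Submodule.Quotient.mk_eq_zero _).mp hx)
    rw [Submodule.Quotient.mk_add, (Submodule.Quotient.mk_eq_zero _).mpr ha, zero_add]
    have h := Submodule.mem_map_of_mem
      (f := Submodule.mkQ (Ideal.span {(m : A)} • ⊤ : Submodule A M)) hb
    rw [Submodule.map_smul''] at h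
    exact Submodule.smul_mono le_rfl le_top h
  · refine ⟨r, le_rfl, fun y => ?_⟩
    obtain ⟨y, rfl⟩ := Submodule.Quotient.mk_surjective _ y
    refine ⟨Submodule.Quotient.mk y ⊗ₜ[A] 1, ?_⟩
    rw [cotorCanonMap, canonMap_tmul_one]
    rfl
end

section
/- Let p be a prime, A a commutative ring, I, J ⊆ A ideals, and r ≥ 1. Then W_r(I) + W_r(J) = W_r(I + J) as ideals of W_r(A). -/
open Function

/-- The functorial ring homomorphism `W_r(A) → W_r(B)` induced by a ring homomorphism
`f : A → B`, obtained by descending `W(A) → W(B) → W_r(B)` along the surjection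
`W(A) → W_r(A)` (with the canonical set-theoretic section). -/
noncomputable def wittMap (p r : ℕ) [hp : Fact p.Prime] {A B : Type*} [CommRing A] [CommRing B]
    (f : A →+* B) : TruncatedWittVector p r A →+* TruncatedWittVector p r B :=
  (WittVector.truncate r).liftOfRightInverse TruncatedWittVector.out
    (fun x => TruncatedWittVector.truncateFun_out x)
    ⟨(WittVector.truncate r).comp (WittVector.map f), fun x hx => by
      rw [RingHom.mem_ker, RingHom.comp_apply, ← RingHom.mem_ker,
        WittVector.mem_ker_truncate]
      intro i hi
      rw [WittVector.map_coeff, (WittVector.mem_ker_truncate r x).mp hx i hi, map_zero]⟩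

/-- The ideal `W_r(I) ⊆ W_r(A)`: the kernel of the natural surjection `W_r(A) → W_r(A/I)`. -/
noncomputable def wittIdeal (p r : ℕ) [Fact p.Prime] {A : Type*} [CommRing A] (I : Ideal A) :
    Ideal (TruncatedWittVector p r A) :=
  RingHom.ker (wittMap p r (Ideal.Quotient.mk I))

theorem wittMap_coeff (p r : ℕ) [Fact p.Prime] {A B : Type*} [CommRing A] [CommRing B]
    (f : A →+* B) (x : TruncatedWittVector p r A) (i : Fin r) :
    (wittMap p r f x).coeff i = f (x.coeff i) := by
  obtain ⟨y, rfl⟩ := WittVector.truncate_surjective p r A x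
  have h : wittMap p r f (WittVector.truncate r y) =
      WittVector.truncate r (WittVector.map f y) :=
    RingHom.liftOfRightInverse_comp_apply _ _ _ _ y
  rw [h, WittVector.coeff_truncate, WittVector.coeff_truncate, WittVector.map_coeff]

theorem mem_wittIdeal (p r : ℕ) [Fact p.Prime] {A : Type*} [CommRing A] (I : Ideal A)
    (x : TruncatedWittVector p r A) : x ∈ wittIdeal p r I ↔ ∀ i, x.coeff i ∈ I := by
  rw [wittIdeal, RingHom.mem_ker, TruncatedWittVector.ext_iff]
  simp only [wittMap_coeff, TruncatedWittVector.coeff_zero, Ideal.Quotient.eq_zero_iff_mem]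

/-- Truncated Witt vectors that agree coefficientwise modulo `I` differ by an element of
`W_r(I)`. -/
theorem sub_mem_wittIdeal (p r : ℕ) [Fact p.Prime] {A : Type*} [CommRing A] (I : Ideal A)
    {x y : TruncatedWittVector p r A} (h : ∀ i, x.coeff i - y.coeff i ∈ I) :
    x - y ∈ wittIdeal p r I := by
  rw [wittIdeal, RingHom.sub_mem_ker_iff]
  ext i
  rw [wittMap_coeff, wittMap_coeff]
  exact Ideal.Quotient.eq.mpr (h i)

theorem wittIdeal_mono (p r : ℕ) [Fact p.Prime] {A : Type*} [CommRing A] {I J : Ideal A}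
    (h : I ≤ J) : wittIdeal p r I ≤ wittIdeal p r J := fun x hx =>
  (mem_wittIdeal p r J x).mpr fun i => h ((mem_wittIdeal p r I x).mp hx i)

/-- **Statement 5.** Let `p` be a prime, `A` a commutative ring, `I, J ⊆ A` ideals and `r ≥ 1`.
Then `W_r(I) + W_r(J) = W_r(I + J)` as ideals of `W_r(A)`. -/
theorem statement5 (p r : ℕ) [Fact p.Prime] (hr : 1 ≤ r)
    (A : Type*) [CommRing A] (I J : Ideal A) :
    wittIdeal p r I + wittIdeal p r J = wittIdeal p r (I + J) := by
  refine le_antisymm (sup_le (wittIdeal_mono p r le_sup_left) (wittIdeal_mono p r le_sup_right)) ?_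
  intro x hx
  rw [mem_wittIdeal] at hx
  choose a ha b hb hab using fun i => Submodule.mem_sup.mp (hx i)
  refine Submodule.mem_sup.mpr ⟨TruncatedWittVector.mk p a, ?_, x - TruncatedWittVector.mk p a,
    sub_mem_wittIdeal p r J fun i => ?_, add_sub_cancel _ _⟩
  · simpa only [mem_wittIdeal, TruncatedWittVector.coeff_mk] using ha
  · rw [TruncatedWittVector.coeff_mk, ← hab i, add_sub_cancel_left]
    exact hb i
end

section
/- Let p be a prime, A a commutative ring, I ⊆ A a finitely generated ideal, and r ≥ 1. Then there exists M ≥ 1 such that I^M is contained in the ideal of A generated by the image F^{r-1}(W_r(I)), where F^{r-1} : W_r(A) → A is the (r−1)-fold iterated Witt vector Frobenius. -/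
open Function

/-- The `(r-1)`-fold iterated Witt vector Frobenius `F^{r-1} : W_r(A) → W_1(A) = A`, computed by
lifting a truncated Witt vector to `W(A)` (by zero-extension), applying the Frobenius ring
endomorphism of `W(A)` `r-1` times, and taking the first component (the identification
`W_1(A) = A`). -/
noncomputable def wittIterFrobenius (p r : ℕ) [Fact p.Prime] {A : Type*} [CommRing A]
    (x : TruncatedWittVector p r A) : A :=
  ((⇑(WittVector.frobenius (p := p) (R := A)))^[r - 1] x.out).coeff 0

theorem wittMap_truncate (p r : ℕ) [Fact p.Prime] {A B : Type*} [CommRing A] [CommRing B]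
    (f : A →+* B) (x : WittVector p A) :
    wittMap p r f (WittVector.truncate r x) = WittVector.truncate r (WittVector.map f x) :=
  RingHom.liftOfRightInverse_comp_apply _ _ _ _ x

theorem coeff_zero_frobenius_iterate (p k : ℕ) [Fact p.Prime] {A : Type*} [CommRing A]
    (x : WittVector p A) :
    ((⇑(WittVector.frobenius (p := p) (R := A)))^[k] x).coeff 0 =
      WittVector.ghostComponent k x := by
  have h : ∀ n, WittVector.ghostComponent n
      ((⇑(WittVector.frobenius (p := p) (R := A)))^[k] x) =
        WittVector.ghostComponent (n + k) x := by
    induction k with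
    | zero => intro n; rfl
    | succ k ih =>
      intro n
      rw [iterate_succ_apply', WittVector.ghostComponent_frobenius, ih, add_right_comm, add_assoc]
  have h0 := h 0
  rw [zero_add] at h0
  rw [← h0]
  simp [WittVector.ghostComponent_apply, wittPolynomial_zero]

theorem out_truncate_teichmuller (p r : ℕ) [Fact p.Prime] (hr : 1 ≤ r) {A : Type*} [CommRing A]
    (a : A) :
    (WittVector.truncate r (WittVector.teichmuller p a)).out = WittVector.teichmuller p a := by
  ext i
  by_cases hi : i < r
  · exact (TruncatedWittVector.coeff_out _ ⟨i, hi⟩).trans (WittVector.coeff_truncate _ ⟨i, hi⟩)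
  · rw [WittVector.teichmuller_coeff_pos p a i (by omega)]
    simp [TruncatedWittVector.out, hi]

theorem wittIterFrobenius_truncate_teichmuller (p r : ℕ) [Fact p.Prime] (hr : 1 ≤ r)
    {A : Type*} [CommRing A] (a : A) :
    wittIterFrobenius p r (WittVector.truncate r (WittVector.teichmuller p a)) =
      a ^ p ^ (r - 1) := by
  rw [wittIterFrobenius, out_truncate_teichmuller p r hr, coeff_zero_frobenius_iterate,
    WittVector.ghostComponent_teichmuller]

theorem truncate_teichmuller_mem_wittIdeal (p r : ℕ) [Fact p.Prime] {A : Type*} [CommRing A]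
    {I : Ideal A} {a : A} (ha : a ∈ I) :
    WittVector.truncate r (WittVector.teichmuller p a) ∈ wittIdeal p r I := by
  rw [wittIdeal, RingHom.mem_ker, wittMap_truncate, WittVector.map_teichmuller,
    Ideal.Quotient.eq_zero_iff_mem.mpr ha, WittVector.teichmuller_zero, map_zero]

/-- **Statement 9.** Let `p` be a prime, `A` a commutative ring, `I ⊆ A` a finitely generated
ideal and `r ≥ 1`.  Then there exists `M ≥ 1` such that `I^M` is contained in the ideal of `A`
generated by the image `F^{r-1}(W_r(I))` of `W_r(I)` under the `(r-1)`-fold iterated Witt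
vector Frobenius `F^{r-1} : W_r(A) → A`. -/
theorem statement9 (p r : ℕ) [Fact p.Prime] (hr : 1 ≤ r)
    (A : Type*) [CommRing A] (I : Ideal A) (hI : I.FG) :
    ∃ M : ℕ, 1 ≤ M ∧
      I ^ M ≤ Ideal.span (wittIterFrobenius p r '' (wittIdeal p r I : Set (TruncatedWittVector p r A))) := by
  obtain ⟨n, hn⟩ := Ideal.exists_pow_le_of_le_radical_of_fg (J := Ideal.span
    (wittIterFrobenius p r '' (wittIdeal p r I : Set (TruncatedWittVector p r A))))
    (fun a ha => ⟨p ^ (r - 1), Ideal.subset_span ⟨_, truncate_teichmuller_mem_wittIdeal p r ha,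
      wittIterFrobenius_truncate_teichmuller p r hr a⟩⟩) hI
  exact ⟨n + 1, n.succ_pos, (Ideal.pow_le_pow_right n.le_succ).trans hn⟩
end

section
/- Let p be a prime, A a commutative ring, I ⊆ A a finitely generated ideal, and r ≥ 1. View A as a W_r(A)-algebra via the (r−1)-fold iterated Frobenius F^{r−1} : W_r(A) → A. Then the natural ring homomorphisms A ⊗_{W_r(A)} W_r(A/I^s) → A/I^s induce an isomorphism of pro rings {A ⊗_{W_r(A)} W_r(A/I^s)}_s → {A/I^s}_s; equivalently, the chains of ideals {I^s}_s and {(F^{r−1}(W_r(I^s)))·A}_s of A are intertwined: each member of either chain contains some member of the other. -/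
open Function

theorem WittVector.frobenius_iterate_coeff_zero {p : ℕ} [Fact p.Prime] {A : Type*} [CommRing A]
    (n : ℕ) (x : WittVector p A) :
    ((⇑(WittVector.frobenius (p := p) (R := A)))^[n] x).coeff 0 =
      WittVector.ghostComponent n x := by
  have h (m : ℕ) : WittVector.ghostComponent m
      ((⇑(WittVector.frobenius (p := p) (R := A)))^[n] x) =
        WittVector.ghostComponent (m + n) x := by
    induction n generalizing m with
    | zero => rfl
    | succ n ih =>
      rw [iterate_succ_apply', WittVector.ghostComponent_frobenius, ih, Nat.add_right_comm,
        Nat.add_assoc]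
  rw [← Nat.zero_add n, ← h 0]
  simp [WittVector.ghostComponent_apply]

theorem mem_wittIdeal_iff {p r : ℕ} [Fact p.Prime] {A : Type*} [CommRing A] {I : Ideal A}
    {x : TruncatedWittVector p r A} : x ∈ wittIdeal p r I ↔ ∀ i, x.coeff i ∈ I := by
  have h : wittMap p r (Ideal.Quotient.mk I) x =
      WittVector.truncate r (WittVector.map (Ideal.Quotient.mk I) x.out) := rfl
  rw [wittIdeal, RingHom.mem_ker, h, ← RingHom.mem_ker, WittVector.mem_ker_truncate]
  simp only [WittVector.map_coeff, Ideal.Quotient.eq_zero_iff_mem]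
  refine ⟨fun h i => by simpa using h i i.2, fun h i hi => ?_⟩
  simpa [TruncatedWittVector.out, hi] using h ⟨i, hi⟩

theorem wittIterFrobenius_mem {p r : ℕ} [Fact p.Prime] {A : Type*} [CommRing A] {I : Ideal A}
    {x : TruncatedWittVector p r A} (hx : x ∈ wittIdeal p r I) : wittIterFrobenius p r x ∈ I := by
  have h (i : ℕ) : x.out.coeff i ∈ I := by
    by_cases hi : i < r
    · simpa [TruncatedWittVector.out, hi] using mem_wittIdeal_iff.mp hx ⟨i, hi⟩
    · simp [TruncatedWittVector.out, hi]
  rw [wittIterFrobenius, WittVector.frobenius_iterate_coeff_zero,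
    WittVector.ghostComponent_apply, aeval_wittPolynomial]
  exact I.sum_mem fun i _ =>
    I.mul_mem_left _ (I.pow_mem_of_mem (h i) _ (pow_pos (Fact.out : p.Prime).pos _))

theorem pow_mem_image_wittIterFrobenius {p r : ℕ} [Fact p.Prime] (hr : 1 ≤ r) {A : Type*}
    [CommRing A] {I : Ideal A} {a : A} (ha : a ∈ I) :
    a ^ p ^ (r - 1) ∈
      wittIterFrobenius p r '' (wittIdeal p r I : Set (TruncatedWittVector p r A)) := by
  have h : (WittVector.truncateFun r (WittVector.teichmuller p a)).out =
      WittVector.teichmuller p a := by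
    ext i
    by_cases hi : i < r
    · simp [TruncatedWittVector.out, hi]
    · simp [TruncatedWittVector.out, hi,
        WittVector.teichmuller_coeff_pos p a i (by lia)]
  refine ⟨WittVector.truncateFun r (WittVector.teichmuller p a), mem_wittIdeal_iff.mpr ?_, ?_⟩
  · intro i
    rw [WittVector.coeff_truncateFun]
    rcases Nat.eq_zero_or_pos (i : ℕ) with hi | hi
    · simpa [hi] using ha
    · simp [WittVector.teichmuller_coeff_pos p a i hi]
  · rw [wittIterFrobenius, h, WittVector.frobenius_iterate_coeff_zero,
      WittVector.ghostComponent_teichmuller]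

/-- **Statement 10.** Let `p` be a prime, `A` a commutative ring, `I ⊆ A` a finitely generated
ideal and `r ≥ 1`.  View `A` as a `W_r(A)`-algebra via the `(r-1)`-fold iterated Frobenius
`F^{r-1} : W_r(A) → A`.  Then the natural ring homomorphisms
`A ⊗_{W_r(A)} W_r(A/I^s) → A/I^s` induce an isomorphism of pro rings
`{A ⊗_{W_r(A)} W_r(A/I^s)}_s → {A/I^s}_s`; equivalently, the chains of ideals `{I^s}_s` and
`{F^{r-1}(W_r(I^s))·A}_s` of `A` are intertwined: each member of either chain contains some
member of the other chain. -/
theorem statement10 (p r : ℕ) [Fact p.Prime] (hr : 1 ≤ r)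
    (A : Type*) [CommRing A] (I : Ideal A) (hI : I.FG) :
    (∀ s : ℕ, ∃ t : ℕ,
      I ^ t ≤ Ideal.span (wittIterFrobenius p r '' (wittIdeal p r (I ^ s) : Set (TruncatedWittVector p r A)))) ∧
    (∀ s : ℕ, ∃ t : ℕ,
      Ideal.span (wittIterFrobenius p r '' (wittIdeal p r (I ^ t) : Set (TruncatedWittVector p r A))) ≤ I ^ s) := by
  refine ⟨fun s => Ideal.exists_pow_le_of_le_radical_of_fg (fun x hx => ?_) hI, fun s => ⟨s, ?_⟩⟩
  · refine ⟨s * p ^ (r - 1), ?_⟩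
    rw [pow_mul]
    exact Ideal.subset_span (pow_mem_image_wittIterFrobenius hr (Ideal.pow_mem_pow hx s))
  · rw [Ideal.span_le]
    rintro _ ⟨x, hx, rfl⟩
    exact wittIterFrobenius_mem hx
end

section
/- Let p be a prime, A a commutative F-finite ℤ_(p)-algebra, and r ≥ 1. Then W_r(A) is again an F-finite ℤ_(p)-algebra; in particular, W_r(A)/pW_r(A) is finitely generated as an algebra over its subring of p-th powers. -/
/-- A commutative ring is a `ℤ_(p)`-algebra when every integer coprime to `p` is invertible
in it. -/
def IsZpAlgebra (p : ℕ) (A : Type*) [CommRing A] : Prop :=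
  ∀ n : ℤ, IsCoprime n (p : ℤ) → IsUnit (n : A)

/-- A `ℤ_(p)`-algebra `A` is F-finite when the `𝔽_p`-algebra `A/pA` is finitely generated as an
algebra over its subring of `p`-th powers, i.e. when `A/pA` is generated, as a ring, by its
`p`-th powers together with finitely many elements. -/
def IsFFinite (p : ℕ) (A : Type*) [CommRing A] : Prop :=
  ∃ T : Finset (A ⧸ Ideal.span {(p : A)}),
    Subring.closure
      ((Set.range fun x : A ⧸ Ideal.span {(p : A)} => x ^ p) ∪ (T : Set (A ⧸ Ideal.span {(p : A)}))) = ⊤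

namespace FFinite

/-- The `p`-th power map on a ring in which the prime `p` vanishes. Unlike `frobenius`, it is
available for the zero ring. -/
def powHom (p : ℕ) [hp : Fact p.Prime] {Q : Type*} [CommRing Q] (h0 : (p : Q) = 0) : Q →+* Q where
  toFun x := x ^ p
  map_one' := one_pow p
  map_mul' x y := mul_pow x y p
  map_zero' := zero_pow hp.out.ne_zero
  map_add' x y := by
    obtain ⟨r, hr⟩ := exists_add_pow_prime_eq hp.out x y
    rw [hr, h0]; ring

@[simp]
theorem powHom_apply (p : ℕ) [Fact p.Prime] {Q : Type*} [CommRing Q] (h0 : (p : Q) = 0) (x : Q) :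
    powHom p h0 x = x ^ p := rfl

theorem _root_.RingHom.finiteType_iff_exists_closure_eq_top {P Q : Type*} [CommRing P] [CommRing Q]
    (f : P →+* Q) :
    f.FiniteType ↔ ∃ T : Finset Q, Subring.closure (Set.range f ∪ (T : Set Q)) = ⊤ := by
  algebraize [f]
  have hcl (T : Set Q) : Subring.closure (Set.range f ∪ T) = ⊤ ↔ Algebra.adjoin P T = ⊤ := by
    have h : (Algebra.adjoin P T).toSubring = Subring.closure (Set.range f ∪ T) :=
      Algebra.adjoin_eq_ring_closure T
    rw [← h, Algebra.toSubring_eq_top]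
  simp only [hcl]
  exact ⟨fun hf => hf.out, fun hT => ⟨hT⟩⟩

/-- A ring is finite over its `p`-th powers as soon as it is finitely generated over them. -/
theorem powHom_finite_iff (p : ℕ) [hp : Fact p.Prime] {Q : Type*} [CommRing Q] (h0 : (p : Q) = 0) :
    (powHom p h0).Finite ↔
      ∃ T : Finset Q, Subring.closure ((Set.range fun x : Q => x ^ p) ∪ (T : Set Q)) = ⊤ := by
  refine Iff.trans ⟨RingHom.Finite.finiteType, RingHom.IsIntegral.to_finite fun x => ?_⟩
    (RingHom.finiteType_iff_exists_closure_eq_top (powHom p h0))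
  exact ⟨Polynomial.X ^ p - Polynomial.C x, Polynomial.monic_X_pow_sub_C x hp.out.ne_zero,
    by simp⟩

/-- Finiteness of a ring homomorphism `f : P → M` can be checked on an extension
`Q → M → B → 0`, where `v : Q → M` is semilinear along `h : P → Q`. -/
theorem finite_of_extension {P Q M B : Type*} [CommRing P] [CommRing Q] [CommRing M] [CommRing B]
    (f : P →+* M) (g : M →+* B) (h : P →+* Q) (v : Q →+ M) (hg : Function.Surjective g)
    (hgv : ∀ m, g m = 0 ↔ m ∈ Set.range v) (hv : ∀ x y, v (h x * y) = f x * v y)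
    (hh : h.Finite) (hgf : (g.comp f).Finite) : f.Finite := by
  algebraize [f, h, g.comp f]
  let v' : Q →ₗ[P] M := { v with
    map_smul' x y := by
      rw [Algebra.smul_def, RingHom.id_apply, Algebra.smul_def]
      exact hv x y }
  let g' : M →ₗ[P] B := { g with
    map_smul' x y := by
      rw [Algebra.smul_def, RingHom.id_apply, Algebra.smul_def]
      exact map_mul g (f x) y }
  exact Module.Finite.of_exact (f := v') (g := g') hgv hg

/-- Finiteness over `p`-th powers descends along surjections. -/
theorem powHom_finite_of_surjective (p : ℕ) [Fact p.Prime] {Q R : Type*} [CommRing Q] [CommRing R]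
    (hQ : (p : Q) = 0) (hR : (p : R) = 0) (f : Q →+* R) (hf : Function.Surjective f)
    (h : (powHom p hQ).Finite) : (powHom p hR).Finite := by
  refine RingHom.Finite.of_comp_finite (f := f) ?_
  have : (powHom p hR).comp f = f.comp (powHom p hQ) := by ext; simp
  rw [this]
  exact (RingHom.Finite.of_surjective f hf).comp h

end FFinite

namespace WittVector

variable {p : ℕ} [hp : Fact p.Prime] {A : Type*} [CommRing A]

theorem frobenius_teichmuller (a : A) :
    frobenius (teichmuller p a) = teichmuller p (a ^ p) := by
  have h₁ (x : MvPolynomial A ℚ) :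
      frobenius (teichmuller p x) = teichmuller p (x ^ p) := by
    apply (ghostMap.bijective_of_invertible p (MvPolynomial A ℚ)).1
    ext n
    simp only [ghostMap_apply, ghostComponent_frobenius, ghostComponent_teichmuller]
    rw [← pow_mul, ← pow_succ']
  have h₂ (x : MvPolynomial A ℤ) :
      frobenius (teichmuller p x) = teichmuller p (x ^ p) := by
    apply map_injective (MvPolynomial.map (Int.castRingHom ℚ))
      (MvPolynomial.map_injective _ Int.cast_injective)
    rw [(frobenius_isPoly p).map, map_teichmuller, map_teichmuller, h₁, map_pow (MvPolynomial.map _)]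
  obtain ⟨x, rfl⟩ := MvPolynomial.counit_surjective A a
  rw [← map_teichmuller, ← (frobenius_isPoly p).map, h₂, map_teichmuller, map_pow (MvPolynomial.counit A)]

theorem exists_eq_verschiebung {x : WittVector p A} (hx : constantCoeff x = 0) :
    ∃ y, x = verschiebung y :=
  ⟨x.shift 1, by
    rw [verschiebung_shift x 0 (fun i hi => by
      rw [zero_add, Nat.lt_one_iff] at hi
      exact hi ▸ hx)]
    ext; simp [shift]⟩

theorem dvd_frobenius_sub_pow (x : WittVector p A) :
    (p : WittVector p A) ∣ frobenius x - x ^ p := by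
  obtain ⟨z, hz⟩ := exists_eq_verschiebung (x := x - teichmuller p (x.coeff 0)) (by
    rw [map_sub]
    exact sub_self _)
  obtain ⟨r, hr⟩ := exists_add_pow_prime_eq hp.out (verschiebung z) (teichmuller p (x.coeff 0))
  have hV : verschiebung z ^ 2 = (p : WittVector p A) * verschiebung (z ^ 2) := by
    rw [sq, ← verschiebung_mul_frobenius, frobenius_verschiebung, ← mul_assoc, ← sq,
      ← nsmul_eq_mul', map_nsmul, nsmul_eq_mul]
  have hVp : (p : WittVector p A) ∣ verschiebung z ^ p :=
    (Dvd.intro _ hV.symm).trans (pow_dvd_pow _ hp.out.two_le)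
  rw [eq_add_of_sub_eq hz, hr, map_add, frobenius_verschiebung, frobenius_teichmuller, map_pow]
  obtain ⟨s, hs⟩ := hVp
  rw [hs]
  exact ⟨z - s - verschiebung z * teichmuller p (x.coeff 0) * r, by ring⟩

theorem exists_sub_mul_mem_ker_truncate {m : A} {n : ℕ} (hn : (n : A) * m = 1) (k : ℕ)
    (w : WittVector p A) : ∃ u, w - (n : WittVector p A) * u ∈ RingHom.ker (truncate (p := p) (R := A) k) := by
  induction k generalizing w with
  | zero => exact ⟨0, (mem_ker_truncate _ _).2 (by simp)⟩
  | succ k ih =>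
    obtain ⟨w', hw'⟩ := exists_eq_verschiebung
        (x := w - (n : WittVector p A) * teichmuller p (m * w.coeff 0)) (by
      rw [map_sub, map_mul, map_natCast]
      change w.coeff 0 - n * (m * w.coeff 0) = 0
      linear_combination (- w.coeff 0) * hn)
    obtain ⟨u, hu⟩ := ih w'
    refine ⟨teichmuller p (m * w.coeff 0) + verschiebung u, ?_⟩
    have : w - (n : WittVector p A) * (teichmuller p (m * w.coeff 0) + verschiebung u) =
        verschiebung (w' - (n : WittVector p A) * u) := by
      rw [mul_add, ← sub_sub, hw', map_sub, ← nsmul_eq_mul, ← nsmul_eq_mul, map_nsmul]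
    rw [this]
    rw [mem_ker_truncate] at hu ⊢
    rintro (_ | i) hi
    · exact verschiebung_coeff_zero _
    · rw [verschiebung_coeff_succ]; exact hu i (by omega)

variable (p A) in
/-- The ideal `(p, V^n W(A))` of `W(A)`, whose quotient is `W_n(A) / p`. -/
noncomputable def pTruncIdeal (n : ℕ) : Ideal (WittVector p A) :=
  Ideal.span {(p : WittVector p A)} ⊔ RingHom.ker (truncate (p := p) (R := A) n)

theorem mem_pTruncIdeal {n : ℕ} {x : WittVector p A} :
    x ∈ pTruncIdeal p A n ↔ ∃ a b, (∀ i < n, b.coeff i = 0) ∧ x = a * p + b := by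
  simp only [pTruncIdeal, Submodule.mem_sup, Ideal.mem_span_singleton', mem_ker_truncate]
  constructor
  · rintro ⟨_, ⟨a, rfl⟩, b, hb, rfl⟩
    exact ⟨a, b, hb, rfl⟩
  · rintro ⟨a, b, hb, rfl⟩
    exact ⟨_, ⟨a, rfl⟩, b, hb, rfl⟩

theorem natCast_eq_zero_pTruncQuot (n : ℕ) : (p : WittVector p A ⧸ pTruncIdeal p A n) = 0 := by
  rw [← map_natCast (Ideal.Quotient.mk _), Ideal.Quotient.eq_zero_iff_mem]
  exact Ideal.mem_sup_left (Ideal.mem_span_singleton_self _)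

theorem pTruncIdeal_succ_le (n : ℕ) : pTruncIdeal p A (n + 1) ≤ pTruncIdeal p A n := by
  intro x
  simp only [mem_pTruncIdeal]
  rintro ⟨a, b, hb, rfl⟩
  exact ⟨a, b, fun i hi => hb i (by omega), rfl⟩

theorem verschiebung_mem_pTruncIdeal {n : ℕ} {x : WittVector p A} (hx : x ∈ pTruncIdeal p A n) :
    verschiebung x ∈ pTruncIdeal p A (n + 1) := by
  obtain ⟨a, b, hb, rfl⟩ := mem_pTruncIdeal.1 hx
  refine mem_pTruncIdeal.2 ⟨verschiebung a, verschiebung b, ?_, ?_⟩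
  · rintro (_ | i) hi
    · exact verschiebung_coeff_zero _
    · rw [verschiebung_coeff_succ]; exact hb i (by omega)
  · rw [map_add, ← nsmul_eq_mul', map_nsmul, nsmul_eq_mul']

variable (p A) in
/-- The map `W_n(A) / p → W_{n+1}(A) / p` induced by the Verschiebung. -/
noncomputable def verschiebungQuot (n : ℕ) :
    WittVector p A ⧸ pTruncIdeal p A n →+ WittVector p A ⧸ pTruncIdeal p A (n + 1) :=
  QuotientAddGroup.lift (pTruncIdeal p A n).toAddSubgroup
    ((Ideal.Quotient.mk (pTruncIdeal p A (n + 1))).toAddMonoidHom.comp verschiebung)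
    fun _ hx => Ideal.Quotient.eq_zero_iff_mem.2 (verschiebung_mem_pTruncIdeal hx)

theorem verschiebungQuot_mk (n : ℕ) (x : WittVector p A) :
    verschiebungQuot p A n (Ideal.Quotient.mk _ x) = Ideal.Quotient.mk _ (verschiebung x) := rfl

theorem verschiebungQuot_pow_mul (n : ℕ) (x y : WittVector p A) :
    verschiebungQuot p A n (Ideal.Quotient.mk _ ((x ^ p) ^ p * y)) =
      Ideal.Quotient.mk _ (x ^ p * verschiebung y) := by
  have h : (Ideal.Quotient.mk (pTruncIdeal p A n)) ((x ^ p) ^ p * y) =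
      Ideal.Quotient.mk _ (y * frobenius (x ^ p)) := by
    obtain ⟨s, hs⟩ := dvd_frobenius_sub_pow (x ^ p)
    rw [eq_add_of_sub_eq hs, map_mul, map_mul, map_add, map_mul _ (p : WittVector p A),
      map_natCast, natCast_eq_zero_pTruncQuot]
    ring
  rw [h, verschiebungQuot_mk, verschiebung_mul_frobenius, mul_comm]

theorem constantCoeff_mem_of_mem_pTruncIdeal {n : ℕ} {x : WittVector p A}
    (hx : x ∈ pTruncIdeal p A (n + 1)) :
    Ideal.Quotient.mk (Ideal.span {(p : A)}) (constantCoeff x) = 0 := by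
  obtain ⟨a, b, hb, rfl⟩ := mem_pTruncIdeal.1 hx
  have : constantCoeff b = 0 := hb 0 (by omega)
  rw [map_add, this, add_zero, map_mul, map_natCast, Ideal.Quotient.eq_zero_iff_mem]
  exact Ideal.mul_mem_left _ _ (Ideal.mem_span_singleton_self _)

variable (p A) in
/-- The projection `W_{n+1}(A) / p → A / p`. -/
noncomputable def constantCoeffQuot (n : ℕ) :
    WittVector p A ⧸ pTruncIdeal p A (n + 1) →+* A ⧸ Ideal.span {(p : A)} :=
  Ideal.Quotient.lift _ ((Ideal.Quotient.mk _).comp constantCoeff)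
    fun _ hx => constantCoeff_mem_of_mem_pTruncIdeal hx

theorem constantCoeffQuot_mk (n : ℕ) (x : WittVector p A) :
    constantCoeffQuot p A n (Ideal.Quotient.mk _ x) = Ideal.Quotient.mk _ (constantCoeff x) := rfl

theorem constantCoeffQuot_surjective (n : ℕ) : Function.Surjective (constantCoeffQuot p A n) := by
  intro y
  obtain ⟨a, rfl⟩ := Ideal.Quotient.mk_surjective y
  exact ⟨Ideal.Quotient.mk _ (teichmuller p a), rfl⟩

theorem constantCoeffQuot_eq_zero_iff (n : ℕ) (m : WittVector p A ⧸ pTruncIdeal p A (n + 1)) :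
    constantCoeffQuot p A n m = 0 ↔ m ∈ Set.range (verschiebungQuot p A n) := by
  constructor
  · obtain ⟨x, rfl⟩ := Ideal.Quotient.mk_surjective m
    rw [constantCoeffQuot_mk, Ideal.Quotient.eq_zero_iff_mem, Ideal.mem_span_singleton']
    rintro ⟨a, ha⟩
    obtain ⟨z, hz⟩ := exists_eq_verschiebung (x := x - teichmuller p a * (p : WittVector p A)) (by
      rw [map_sub, map_mul, map_natCast, ← ha]
      exact sub_self _)
    refine ⟨Ideal.Quotient.mk _ z, ?_⟩
    rw [verschiebungQuot_mk, ← hz, map_sub, map_mul, map_natCast, natCast_eq_zero_pTruncQuot,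
      mul_zero, sub_zero]
  · rintro ⟨y, rfl⟩
    obtain ⟨y, rfl⟩ := Ideal.Quotient.mk_surjective y
    rw [verschiebungQuot_mk, constantCoeffQuot_mk]
    have : constantCoeff (verschiebung y) = 0 := verschiebung_coeff_zero y
    rw [this, map_zero]

open FFinite in
theorem powHom_pTruncQuot_finite (h0 : (p : A ⧸ Ideal.span {(p : A)}) = 0)
    (hA : (powHom p h0).Finite) (n : ℕ) :
    (powHom p (natCast_eq_zero_pTruncQuot (p := p) (A := A) n)).Finite := by
  induction n with
  | zero =>
    have : Subsingleton (WittVector p A ⧸ pTruncIdeal p A 0) := by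
      rw [Ideal.Quotient.subsingleton_iff, Ideal.eq_top_iff_one]
      exact mem_pTruncIdeal.2 ⟨0, 1, by simp, by simp⟩
    exact RingHom.Finite.of_surjective _ fun x => ⟨0, Subsingleton.elim _ _⟩
  | succ n ih =>
    let π := Ideal.Quotient.factor (pTruncIdeal_succ_le (p := p) (A := A) n)
    have hπ : π.Finite := RingHom.Finite.of_surjective _ (Ideal.Quotient.factor_surjective _)
    refine finite_of_extension _ (constantCoeffQuot p A n) (((powHom p _).comp (powHom p _)).comp π)
      (verschiebungQuot p A n) (constantCoeffQuot_surjective n) (constantCoeffQuot_eq_zero_iff n)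
      ?_ ((ih.comp ih).comp hπ) ?_
    · intro x y
      obtain ⟨x, rfl⟩ := Ideal.Quotient.mk_surjective x
      obtain ⟨y, rfl⟩ := Ideal.Quotient.mk_surjective y
      exact verschiebungQuot_pow_mul n x y
    · have : (constantCoeffQuot p A n).comp (powHom p (natCast_eq_zero_pTruncQuot (n + 1))) =
          (powHom p h0).comp (constantCoeffQuot p A n) := by
        ext; simp
      rw [this]
      exact hA.comp (RingHom.Finite.of_surjective _ (constantCoeffQuot_surjective n))

end WittVector

theorem natCast_quot_span_eq_zero (p : ℕ) (A : Type*) [CommRing A] :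
    (p : A ⧸ Ideal.span {(p : A)}) = 0 := by
  rw [← map_natCast (Ideal.Quotient.mk _), Ideal.Quotient.eq_zero_iff_mem]
  exact Ideal.mem_span_singleton_self _

theorem isFFinite_iff_powHom_finite (p : ℕ) [Fact p.Prime] (A : Type*) [CommRing A] :
    IsFFinite p A ↔ (FFinite.powHom p (natCast_quot_span_eq_zero p A)).Finite :=
  (FFinite.powHom_finite_iff p _).symm

theorem IsFFinite.truncatedWittVector (p : ℕ) [Fact p.Prime] (r : ℕ) {A : Type*} [CommRing A]
    (hF : IsFFinite p A) : IsFFinite p (TruncatedWittVector p r A) := by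
  rw [isFFinite_iff_powHom_finite] at hF ⊢
  let f : WittVector p A →+* TruncatedWittVector p r A ⧸
      Ideal.span {(p : TruncatedWittVector p r A)} :=
    (Ideal.Quotient.mk _).comp (WittVector.truncate r)
  have hf : ∀ x ∈ WittVector.pTruncIdeal p A r, f x = 0 := by
    intro x hx
    obtain ⟨a, b, hb, rfl⟩ := WittVector.mem_pTruncIdeal.1 hx
    have hb' : f b = 0 := by
      rw [RingHom.comp_apply, (WittVector.mem_ker_truncate r b).2 hb, map_zero]
    rw [map_add, hb', map_mul, map_natCast, natCast_quot_span_eq_zero, mul_zero, add_zero]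
  exact FFinite.powHom_finite_of_surjective p _ _ (Ideal.Quotient.lift _ f hf)
    (Ideal.Quotient.lift_surjective_of_surjective _ _
      (Ideal.Quotient.mk_surjective.comp (WittVector.truncate_surjective p r A)))
    (WittVector.powHom_pTruncQuot_finite _ hF r)

theorem IsZpAlgebra.truncatedWittVector (p : ℕ) [Fact p.Prime] (r : ℕ) {A : Type*} [CommRing A]
    (hZ : IsZpAlgebra p A) : IsZpAlgebra p (TruncatedWittVector p r A) := by
  have key (n : ℕ) (hn : IsCoprime (n : ℤ) p) : IsUnit (n : TruncatedWittVector p r A) := by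
    obtain ⟨m, hm⟩ := (hZ n hn).exists_right_inv
    rw [Int.cast_natCast] at hm
    obtain ⟨u, hu⟩ := WittVector.exists_sub_mul_mem_ker_truncate (p := p) hm r 1
    rw [RingHom.mem_ker, map_sub, map_one, map_mul, map_natCast, sub_eq_zero] at hu
    exact IsUnit.of_mul_eq_one _ hu.symm
  intro n hn
  obtain ⟨n, rfl | rfl⟩ := n.eq_nat_or_neg
  · simpa using key n hn
  · rw [Int.cast_neg, Int.cast_natCast]
    exact (key n ((IsCoprime.neg_left_iff _ _).1 hn)).neg

/-- **Statement 16.** Let `p` be a prime, `A` a commutative F-finite `ℤ_(p)`-algebra, and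
`r ≥ 1`.  Then the ring `W_r(A)` of `p`-typical Witt vectors of length `r` is again an
F-finite `ℤ_(p)`-algebra; in particular `W_r(A)/pW_r(A)` is finitely generated as an algebra
over its subring of `p`-th powers. -/
theorem statement16 (p : ℕ) [Fact p.Prime] (r : ℕ) (hr : 1 ≤ r)
    (A : Type*) [CommRing A] (hF : IsFFinite p A) (hZ : IsZpAlgebra p A) :
    IsFFinite p (TruncatedWittVector p r A) ∧ IsZpAlgebra p (TruncatedWittVector p r A) :=
  ⟨hF.truncatedWittVector p r, hZ.truncatedWittVector p r⟩
end

section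
/- Let p be a prime and A a commutative Noetherian F-finite ℤ_(p)-algebra. Then for every n ≥ 0 the A-module Ω^n_A ⊗_A A/pA is finitely generated, where Ω^n_A = ⋀^n_A Ω^1_{A/ℤ} is the n-th exterior power of the module of Kähler differentials of A over ℤ. -/
open TensorProduct

/-- If `P = L + I P` with `L` finitely generated, then `P ⊗ A/I` is finite. -/
theorem Submodule.finite_tensor_quotient_of_le_sup_smul {A E : Type*} [CommRing A]
    [AddCommGroup E] [Module A E] (I : Ideal A) (P L : Submodule A E) (hL : L.FG)
    (hLP : L ≤ P) (h : P ≤ L ⊔ I • P) :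
    Module.Finite A (P ⊗[A] (A ⧸ I)) := by
  have : Module.Finite A L := Module.Finite.iff_fg.mpr hL
  let f : L →ₗ[A] P ⧸ (I • ⊤ : Submodule A P) :=
    (Submodule.mkQ _).comp (Submodule.inclusion hLP)
  have hf : Function.Surjective f := by
    intro y
    obtain ⟨⟨x, hx⟩, rfl⟩ := Submodule.mkQ_surjective _ y
    obtain ⟨l, hl, z, hz, rfl⟩ := Submodule.mem_sup.mp (h hx)
    refine ⟨⟨l, hl⟩, ?_⟩
    have hz' : z ∈ (I • ⊤ : Submodule A P).map P.subtype := by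
      simpa [Submodule.map_smul''] using hz
    obtain ⟨w, hw, rfl⟩ := hz'
    refine (Submodule.Quotient.eq _).mpr ?_
    have hw' : Submodule.inclusion hLP ⟨l, hl⟩ - ⟨l + P.subtype w, hx⟩ = -w := by
      ext
      simp
    rw [hw']
    exact neg_mem hw
  have : Module.Finite A (P ⧸ (I • ⊤ : Submodule A P)) := Module.Finite.of_surjective f hf
  exact Module.Finite.equiv (TensorProduct.tensorQuotEquivQuotSMul P I).symm

theorem Submodule.pow_le_pow_sup_smul_pow {A E : Type*} [CommRing A] [Ring E] [Algebra A E]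
    (I : Ideal A) (R L : Submodule A E) (hLR : L ≤ R) (h : R ≤ L ⊔ I • R) (n : ℕ) :
    R ^ n ≤ L ^ n ⊔ I • R ^ n := by
  induction n with
  | zero => simp
  | succ n ih =>
    rw [pow_succ, pow_succ L, Submodule.mul_le]
    intro x hx y hy
    obtain ⟨l, hl, z, hz, rfl⟩ := Submodule.mem_sup.mp (ih hx)
    obtain ⟨l', hl', z', hz', rfl⟩ := Submodule.mem_sup.mp (h hy)
    have hzy : z * (l' + z') ∈ I • (R ^ n * R) := by
      refine Submodule.smul_induction_on hz (fun r hr m hm => ?_) fun u v hu hv => ?_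
      · rw [smul_mul_assoc]
        exact Submodule.smul_mem_smul hr (Submodule.mul_mem_mul hm hy)
      · rw [add_mul]
        exact add_mem hu hv
    have hlz : l * z' ∈ I • (R ^ n * R) := by
      refine Submodule.smul_induction_on hz' (fun r hr m hm => ?_) fun u v hu hv => ?_
      · rw [mul_smul_comm]
        exact Submodule.smul_mem_smul hr
          (Submodule.mul_mem_mul (pow_le_pow_left' hLR n hl) hm)
      · rw [mul_add]
        exact add_mem hu hv
    rw [add_mul, mul_add l, add_assoc]
    exact add_mem (Submodule.mem_sup_left (Submodule.mul_mem_mul hl hl'))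
      (Submodule.mem_sup_right (add_mem hlz hzy))

theorem exteriorPower.finite_tensor_quotient {A M : Type*} [CommRing A] [AddCommGroup M]
    [Module A M] (I : Ideal A) (N : Submodule A M) (hN : N.FG) (h : N ⊔ I • ⊤ = ⊤) (n : ℕ) :
    Module.Finite A ((⋀[A]^n M) ⊗[A] (A ⧸ I)) := by
  have hle : N.map (ExteriorAlgebra.ι A) ≤ LinearMap.range (ExteriorAlgebra.ι A (M := M)) :=
    LinearMap.map_le_range
  refine Submodule.finite_tensor_quotient_of_le_sup_smul I _ _ ((hN.map _).pow n)
    (pow_le_pow_left' hle n) (Submodule.pow_le_pow_sup_smul_pow I _ _ hle ?_ n)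
  rw [LinearMap.range_eq_map, ← Submodule.map_smul'', ← Submodule.map_sup, h]

/-- The differentials of lifts of generators of `A/pA` over its `p`-th powers generate
`Ω[A⁄ℤ]` modulo `p`. -/
theorem IsFFinite.exists_fg_sup_smul_eq_top {p : ℕ} {A : Type*} [CommRing A] (hF : IsFFinite p A) :
    ∃ N : Submodule A (Ω[A⁄ℤ]), N.FG ∧ N ⊔ Ideal.span {(p : A)} • ⊤ = ⊤ := by
  classical
  obtain ⟨T, hT⟩ := hF
  let lift : A ⧸ Ideal.span {(p : A)} → A := Function.surjInv Ideal.Quotient.mk_surjective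
  have hlift (t) : Ideal.Quotient.mk _ (lift t) = t := Function.surjInv_eq _ t
  let D := KaehlerDifferential.D ℤ A
  let N : Submodule A (Ω[A⁄ℤ]) := Submodule.span A (T.image fun t => D (lift t))
  refine ⟨N, ⟨_, rfl⟩, ?_⟩
  set Q := N ⊔ Ideal.span {(p : A)} • ⊤
  have hpQ (x : Ω[A⁄ℤ]) : (p : A) • x ∈ Q :=
    Submodule.mem_sup_right
      (Submodule.smul_mem_smul (Ideal.mem_span_singleton_self _) Submodule.mem_top)
  let S : Subring A :=
    { carrier := {a | D a ∈ Q}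
      mul_mem' := fun {a b} ha hb => by
        simp only [Set.mem_ofPred_eq, Derivation.leibniz] at *
        exact add_mem (Q.smul_mem _ hb) (Q.smul_mem _ ha)
      one_mem' := by simp
      add_mem' := fun {a b} ha hb => by
        simp only [Set.mem_ofPred_eq, map_add] at *
        exact add_mem ha hb
      zero_mem' := by simp
      neg_mem' := fun {a} ha => by
        simp only [Set.mem_ofPred_eq, map_neg] at *
        exact neg_mem ha }
  have hmap : S.map (Ideal.Quotient.mk (Ideal.span {(p : A)})) = ⊤ := by
    rw [eq_top_iff, ← hT, Subring.closure_le, Set.union_subset_iff]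
    constructor
    · rintro _ ⟨x, rfl⟩
      obtain ⟨a, rfl⟩ := Ideal.Quotient.mk_surjective x
      refine ⟨a ^ p, ?_, map_pow _ _ _⟩
      change D (a ^ p) ∈ Q
      rw [Derivation.leibniz_pow, ← Nat.cast_smul_eq_nsmul A]
      exact hpQ _
    · intro t ht
      exact ⟨lift t, Submodule.mem_sup_left
        (Submodule.subset_span (Finset.mem_image_of_mem _ ht)), hlift t⟩
  have hD (a : A) : D a ∈ Q := by
    have ha : Ideal.Quotient.mk (Ideal.span {(p : A)}) a ∈
        S.map (Ideal.Quotient.mk (Ideal.span {(p : A)})) := hmap ▸ Subring.mem_top _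
    obtain ⟨s, hs, hsa⟩ := ha
    obtain ⟨c, hc⟩ := Ideal.mem_span_singleton'.mp (Ideal.Quotient.eq.mp hsa.symm)
    obtain rfl : a = c * p + s := by rw [hc]; ring
    rw [map_add, Derivation.leibniz, Derivation.map_natCast, smul_zero, zero_add]
    exact add_mem (hpQ _) hs
  rw [eq_top_iff, ← KaehlerDifferential.span_range_derivation ℤ A, Submodule.span_le]
  rintro _ ⟨a, rfl⟩
  exact hD a

/-- **Statement 17.** Let `p` be a prime and `A` a commutative Noetherian F-finite
`ℤ_(p)`-algebra.  Then for every `n ≥ 0` the `A`-module `Ω^n_A ⊗_A A/pA` is finitely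
generated, where `Ω^n_A = ⋀^n_A Ω^1_{A/ℤ}` is the `n`-th exterior power of the module of
Kähler differentials of `A` over `ℤ`. -/
theorem statement17 (p : ℕ) (hp : p.Prime) (A : Type*) [CommRing A]
    [IsNoetherianRing A] (hF : IsFFinite p A) (hZ : IsZpAlgebra p A) (n : ℕ) :
    Module.Finite A ((⋀[A]^n (Ω[A⁄ℤ])) ⊗[A] (A ⧸ Ideal.span {(p : A)})) := by
  obtain ⟨N, hN, h⟩ := hF.exists_fg_sup_smul_eq_top
  exact exteriorPower.finite_tensor_quotient _ N hN h n
end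

section
/- Let p be a prime and A a commutative Noetherian F-finite ℤ_(p)-algebra in which p is nilpotent. Then for every n ≥ 0 the A-module Ω^n_A = ⋀^n_A Ω^1_{A/ℤ} is finitely generated. -/
theorem Submodule.eq_top_of_isNilpotent_of_forall_sub_smul_mem {A M : Type*} [CommRing A]
    [AddCommGroup M] [Module A M] (N : Submodule A M) {r : A} (hr : IsNilpotent r)
    (h : ∀ m : M, ∃ m' : M, m - r • m' ∈ N) : N = ⊤ := by
  have key : ∀ (k : ℕ) (m : M), ∃ m' : M, m - r ^ k • m' ∈ N := by
    intro k
    induction k with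
    | zero => exact fun m => ⟨m, by simp⟩
    | succ k ih =>
      intro m
      obtain ⟨m₁, h₁⟩ := ih m
      obtain ⟨m₂, h₂⟩ := h m₁
      refine ⟨m₂, ?_⟩
      have h₃ := N.add_mem h₁ (N.smul_mem (r ^ k) h₂)
      rwa [smul_sub, sub_add_sub_cancel, smul_smul, ← pow_succ] at h₃
  obtain ⟨k, hk⟩ := hr
  refine (Submodule.eq_top_iff' ..).2 fun m => ?_
  obtain ⟨m', hm'⟩ := key k m
  simpa [hk] using hm'

/-- The elements whose derivative lies in a given submodule form a subring. -/
def Derivation.subringOfMem {A M : Type*} [CommRing A] [AddCommGroup M] [Module A M]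
    (d : Derivation ℤ A M) (N : Submodule A M) : Subring A where
  carrier := {a | d a ∈ N}
  mul_mem' {a b} ha hb := by
    simpa using N.add_mem (N.smul_mem a hb) (N.smul_mem b ha)
  one_mem' := by simp
  add_mem' {a b} ha hb := by simpa using N.add_mem ha hb
  zero_mem' := by simp
  neg_mem' {a} ha := by simpa using N.neg_mem ha

theorem Derivation.mem_subringOfMem {A M : Type*} [CommRing A] [AddCommGroup M] [Module A M]
    {d : Derivation ℤ A M} {N : Submodule A M} {a : A} : a ∈ d.subringOfMem N ↔ d a ∈ N :=
  Iff.rfl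

theorem IsFFinite.exists_finset_forall_subring {p : ℕ} {A : Type*} [CommRing A]
    (hF : IsFFinite p A) :
    ∃ T : Finset A, ∀ B : Subring A, (∀ a : A, a ^ p ∈ B) → (∀ a : A, (p : A) * a ∈ B) →
      (∀ t ∈ T, t ∈ B) → B = ⊤ := by
  classical
  obtain ⟨T, hT⟩ := hF
  set π := Ideal.Quotient.mk (Ideal.span {(p : A)})
  choose s hs using Ideal.Quotient.mk_surjective (I := Ideal.span {(p : A)})
  refine ⟨T.image s, fun B hpow hmul hmem => ?_⟩
  have hmap : B.map π = ⊤ := by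
    rw [eq_top_iff, ← hT, Subring.closure_le]
    rintro _ (⟨x, rfl⟩ | ht)
    · exact ⟨s x ^ p, hpow _, by rw [map_pow, hs]⟩
    · exact ⟨s _, hmem _ (Finset.mem_image_of_mem s ht), hs _⟩
  refine eq_top_iff.2 fun a _ => ?_
  obtain ⟨b, hb, hab⟩ : π a ∈ B.map π := hmap ▸ Subring.mem_top _
  obtain ⟨c, hc⟩ := Ideal.mem_span_singleton.1 (Ideal.Quotient.eq.1 hab.symm)
  have := B.add_mem hb (hmul c)
  rwa [← hc, add_sub_cancel] at this

theorem IsFFinite.finite_kaehlerDifferential {p : ℕ} {A : Type*} [CommRing A]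
    (hF : IsFFinite p A) (hnil : IsNilpotent (p : A)) : Module.Finite A (Ω[A⁄ℤ]) := by
  classical
  obtain ⟨T, hT⟩ := hF.exists_finset_forall_subring
  let d := KaehlerDifferential.D ℤ A
  let N := Submodule.span A (T.image d : Set (Ω[A⁄ℤ]))
  let P := LinearMap.range (LinearMap.lsmul A (Ω[A⁄ℤ]) (p : A))
  have hsubring : d.subringOfMem (N ⊔ P) = ⊤ := by
    refine hT _ (fun a => ?_) (fun a => ?_) fun t ht => ?_
    · refine Submodule.mem_sup_right ⟨a ^ (p - 1) • d a, ?_⟩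
      simp [Derivation.leibniz_pow, Nat.cast_smul_eq_nsmul, smul_comm p]
    · refine Submodule.mem_sup_right ⟨d a, ?_⟩
      simp
    · exact Submodule.mem_sup_left
        (Submodule.subset_span (Finset.mem_coe.2 (Finset.mem_image_of_mem d ht)))
  have hsup : N ⊔ P = ⊤ := by
    rw [eq_top_iff, ← KaehlerDifferential.span_range_derivation, Submodule.span_le]
    rintro _ ⟨a, rfl⟩
    exact Derivation.mem_subringOfMem.1 (hsubring ▸ Subring.mem_top a)
  have hN : N = ⊤ := by
    refine N.eq_top_of_isNilpotent_of_forall_sub_smul_mem hnil fun m => ?_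
    obtain ⟨x, hx, _, ⟨m', rfl⟩, hm⟩ := Submodule.mem_sup.1 (hsup ▸ Submodule.mem_top : m ∈ N ⊔ P)
    refine ⟨m', ?_⟩
    rw [← hm]
    simpa using hx
  exact ⟨⟨_, hN⟩⟩

/-- **Statement 18.** Let `p` be a prime and `A` a commutative Noetherian F-finite
`ℤ_(p)`-algebra in which `p` is nilpotent.  Then for every `n ≥ 0` the `A`-module
`Ω^n_A = ⋀^n_A Ω^1_{A/ℤ}` is finitely generated. -/
theorem statement18 (p : ℕ) (hp : p.Prime) (A : Type*) [CommRing A]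
    [IsNoetherianRing A] (hF : IsFFinite p A) (hZ : IsZpAlgebra p A)
    (hnil : IsNilpotent (p : A)) (n : ℕ) :
    Module.Finite A (⋀[A]^n (Ω[A⁄ℤ])) := by
  have := hF.finite_kaehlerDifferential hnil
  infer_instance
end

section
/- Let A be a commutative Noetherian ring, p a prime, and M an A-module which is either flat or finitely generated. Then the p-power torsion of M is bounded: there exists c ≥ 1 such that every element of M killed by some power of p is killed by p^c. Consequently the pro A-module {M[p^r]}_r with transition maps given by multiplication by p vanishes, and in particular the Tate module lim_r M[p^r] is zero. -/
/-- The `a`-power torsion of a Noetherian module is bounded. -/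
theorem exists_pow_smul_eq_zero_of_isNoetherian {A M : Type*} [CommRing A] [AddCommGroup M]
    [Module A M] [IsNoetherian A M] (a : A) :
    ∃ c : ℕ, ∀ x : M, (∃ k : ℕ, a ^ k • x = 0) → a ^ c • x = 0 := by
  obtain ⟨n, hn⟩ := monotone_stabilizes_iff_noetherian.mpr ‹IsNoetherian A M›
    ⟨fun k ↦ Submodule.torsionBy A M (a ^ k),
      fun _ _ h ↦ Submodule.torsionBy_le_torsionBy_of_dvd _ _ (pow_dvd_pow a h)⟩
  refine ⟨n, fun x ⟨k, hk⟩ ↦ ?_⟩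
  have hx : x ∈ Submodule.torsionBy A M (a ^ max n k) :=
    Submodule.torsionBy_le_torsionBy_of_dvd _ _ (pow_dvd_pow a (le_max_right n k))
      ((Submodule.mem_torsionBy_iff _ _).mpr hk)
  have h : Submodule.torsionBy A M (a ^ n) = Submodule.torsionBy A M (a ^ max n k) :=
    hn _ (le_max_left n k)
  exact (Submodule.mem_torsionBy_iff _ _).mp (h ▸ hx)

/-- A bound for the `a`-power torsion of `A` is also one for every flat `A`-module. -/
theorem Module.Flat.pow_smul_eq_zero {A M : Type*} [CommRing A] [AddCommGroup M]
    [Module A M] [Module.Flat A M] {a : A} {c : ℕ}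
    (hc : ∀ b : A, (∃ k : ℕ, a ^ k • b = 0) → a ^ c • b = 0)
    {x : M} {k : ℕ} (hx : a ^ k • x = 0) : a ^ c • x = 0 := by
  obtain ⟨n, b, y, hxy, hb⟩ := Module.Flat.isTrivialRelation_of_sum_smul_eq_zero
    (f := fun _ : Fin 1 ↦ a ^ k) (x := fun _ : Fin 1 ↦ x) (by simpa using hx)
  rw [show x = _ from hxy 0, Finset.smul_sum]
  refine Finset.sum_eq_zero fun j _ ↦ ?_
  rw [← smul_assoc, hc (b 0 j) ⟨k, by simpa using hb j⟩, zero_smul]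


/-- **Statement 19.** Let `A` be a commutative Noetherian ring, `p` a prime, and `M` an
`A`-module which is either flat or finitely generated.  Then:
(1) the `p`-power torsion of `M` is bounded: there is `c ≥ 1` such that every element of `M`
killed by some power of `p` is killed by `p^c`;
(2) consequently the pro `A`-module `{M[p^r]}_r`, with transition maps given by multiplication
by `p` (so the transition from level `s` to level `r ≤ s` is multiplication by `p^(s-r)`),
vanishes: for every `r` there is `s ≥ r` whose transition map to level `r` is zero;
(3) in particular the Tate module `lim_r M[p^r]` is zero: every compatible family vanishes. -/
theorem statement19 (A : Type*) [CommRing A] [IsNoetherianRing A]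
    (p : ℕ) (hp : p.Prime)
    (M : Type*) [AddCommGroup M] [Module A M]
    (hM : Module.Flat A M ∨ Module.Finite A M) :
    (∃ c : ℕ, 1 ≤ c ∧ ∀ x : M, (∃ k : ℕ, (p : A) ^ k • x = 0) → (p : A) ^ c • x = 0) ∧
    (∀ r : ℕ, ∃ s : ℕ, r ≤ s ∧ ∀ x : M, (p : A) ^ s • x = 0 → (p : A) ^ (s - r) • x = 0) ∧
    (∀ f : ℕ → M, (∀ r, (p : A) ^ r • f r = 0) → (∀ r, (p : A) • f (r + 1) = f r) →
      ∀ r, f r = 0) := by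
  have bounded : ∃ c : ℕ, ∀ x : M, (∃ k : ℕ, (p : A) ^ k • x = 0) → (p : A) ^ c • x = 0 := by
    rcases hM with hM | hM
    · obtain ⟨c, hc⟩ := exists_pow_smul_eq_zero_of_isNoetherian (M := A) (p : A)
      exact ⟨c, fun x ⟨_, hk⟩ ↦ Module.Flat.pow_smul_eq_zero hc hk⟩
    · exact exists_pow_smul_eq_zero_of_isNoetherian (p : A)
  obtain ⟨c, hc⟩ := bounded
  refine ⟨⟨c + 1, Nat.le_add_left 1 c, fun x hx ↦ ?_⟩,
    fun r ↦ ⟨r + c, Nat.le_add_right r c, fun x hx ↦ ?_⟩, fun f hf hcompat r ↦ ?_⟩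
  · rw [pow_succ', mul_smul, hc x hx, smul_zero]
  · rw [Nat.add_sub_cancel_left]
    exact hc x ⟨_, hx⟩
  · have transition : ∀ n, (p : A) ^ n • f (r + n) = f r := by
      intro n
      induction n with
      | zero => simp
      | succ n ih => rw [pow_succ, mul_smul, ← add_assoc, hcompat, ih]
    rw [← transition c]
    exact hc _ ⟨_, hf _⟩
end
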